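/- arXiv:1511.02818 — 2 statements merged into one kernel-verified Lean document; each statement's English description precedes it below -/
import Mathlib

section
/- Let (ψ, η) be a solution of problem P^M_r. Then inf_{x∈ℝ} η(x) ≥ min{ (6r)^{−1/2}, (2ω₀)^{−1/2} }. -/
noncomputable section
open MeasureTheory Set Filter Topology

namespace BL

/-- Ω(τ) = ∫₀^τ ω(t) dt. -/
def Om (ω : ℝ → ℝ) (τ : ℝ) : ℝ := ∫ t in (0:ℝ)..τ, ω t

/-- ω₀ = max of |ω| on [0,1]. -/
def om0 (ω : ℝ → ℝ) : ℝ := sSup ((fun t => |ω t|) '' Icc (0:ℝ) 1)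

/-- λ₀ = √(2 max_{[0,1]} Ω). -/
def lam0 (ω : ℝ → ℝ) : ℝ := Real.sqrt (2 * sSup (Om ω '' Icc (0:ℝ) 1))

/-- H_p(p; λ) = (λ² − 2Ω(p))^{-1/2}. -/
def Hp (ω : ℝ → ℝ) (lam p : ℝ) : ℝ := (Real.sqrt (lam ^ 2 - 2 * Om ω p))⁻¹

/-- H(p, λ) = ∫₀^p (λ² − 2Ω(τ))^{-1/2} dτ (the stream solution in hodograph variables). -/
def Hs (ω : ℝ → ℝ) (lam p : ℝ) : ℝ := ∫ τ in (0:ℝ)..p, Hp ω lam τ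

/-- the depth d(λ). -/
def dep (ω : ℝ → ℝ) (lam : ℝ) : ℝ := Hs ω lam 1

/-- 𝓡(λ) = (λ² − 2Ω(1) + 2 d(λ))/3. -/
def RR (ω : ℝ → ℝ) (lam : ℝ) : ℝ := (lam ^ 2 - 2 * Om ω 1 + 2 * dep ω lam) / 3

/-- λ_c is the unique minimiser of 𝓡 on (λ₀, ∞) and r_c = 𝓡(λ_c) the critical value. -/
structure Crit (ω : ℝ → ℝ) (lamc rc : ℝ) : Prop where
  lt : lam0 ω < lamc
  isMin : ∀ lam, lam0 ω < lam → RR ω lamc ≤ RR ω lam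
  uniq : ∀ lam, lam0 ω < lam → RR ω lam = RR ω lamc → lam = lamc
  val : rc = RR ω lamc

/-- The fluid domain D = {0 < y < η(x)}. -/
def dom (η : ℝ → ℝ) : Set (ℝ × ℝ) := {z : ℝ × ℝ | 0 < z.2 ∧ z.2 < η z.1}

/-- Its closure D̄ = {0 ≤ y ≤ η(x)}. -/
def domc (η : ℝ → ℝ) : Set (ℝ × ℝ) := {z : ℝ × ℝ | 0 ≤ z.2 ∧ z.2 ≤ η z.1}

/-- ψ_x (partial derivative within D̄). -/
def px (η : ℝ → ℝ) (ψ : ℝ × ℝ → ℝ) (z : ℝ × ℝ) : ℝ :=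
  fderivWithin ℝ ψ (domc η) z (1, 0)

/-- ψ_y (partial derivative within D̄). -/
def py (η : ℝ → ℝ) (ψ : ℝ × ℝ → ℝ) (z : ℝ × ℝ) : ℝ :=
  fderivWithin ℝ ψ (domc η) z (0, 1)

/-- A solution of problem P^M_r. -/
structure Sol (ω : ℝ → ℝ) (M r : ℝ) (ψ : ℝ × ℝ → ℝ) (η : ℝ → ℝ) : Prop where
  eta_pos : ∀ x, 0 < η x
  eta_lip : LipschitzWith (Real.toNNReal M) η
  smooth : ContDiffOn ℝ 1 ψ (domc η)
  bottom : ∀ x, ψ (x, 0) = 0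
  surface : ∀ x, ψ (x, η x) = 1
  bern : ∀ x, px η ψ (x, η x) ^ 2 + py η ψ (x, η x) ^ 2 + 2 * η x = 3 * r
  unidir : ∀ z ∈ domc η, 0 < py η ψ z
  weak : ∀ φ : ℝ × ℝ → ℝ, ContDiff ℝ (⊤ : ℕ∞) φ → HasCompactSupport φ →
      tsupport φ ⊆ dom η →
      (∫ z in dom η,
        (px η ψ z * fderiv ℝ φ z (1, 0) + py η ψ z * fderiv ℝ φ z (0, 1))) =
      ∫ z in dom η, ω (ψ z) * φ z

/-- Stream (shear-flow) solutions: η is constant and ψ depends only on y. -/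
def IsStream (ψ : ℝ × ℝ → ℝ) (η : ℝ → ℝ) : Prop :=
  (∃ c : ℝ, ∀ x, η x = c) ∧ ∃ u : ℝ → ℝ, ∀ z : ℝ × ℝ, ψ z = u z.2

/-- Stokes-wave solutions: periodic, a single crest per wavelength, symmetric about crests. -/
def IsStokes (ψ : ℝ × ℝ → ℝ) (η : ℝ → ℝ) : Prop :=
  ∃ L : ℝ, 0 < L ∧ (∀ x, η (x + L) = η x) ∧ (∀ z : ℝ × ℝ, ψ (z.1 + L, z.2) = ψ z) ∧
    ∃ xc : ℝ, (∀ x, η (xc + x) = η (xc - x)) ∧ (∀ x, η x ≤ η xc) ∧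
      StrictAntiOn η (Icc xc (xc + L / 2))

/-- Solitary-wave solutions: non-stream, symmetric about the line through the single
crest, asymptoting a stream solution at infinity. -/
def IsSolitary (ω : ℝ → ℝ) (M r : ℝ) (ψ : ℝ × ℝ → ℝ) (η : ℝ → ℝ) : Prop :=
  ¬ IsStream ψ η ∧
  (∃ xc : ℝ, (∀ x, η (xc + x) = η (xc - x)) ∧ ∀ x, η x ≤ η xc) ∧
  ∃ (u : ℝ → ℝ) (c : ℝ), Sol ω M r (fun z => u z.2) (fun _ => c) ∧
    Tendsto η atTop (𝓝 c) ∧ Tendsto η atBot (𝓝 c) ∧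
    ∀ y : ℝ, Tendsto (fun x => ψ (x, y)) atTop (𝓝 (u y)) ∧
      Tendsto (fun x => ψ (x, y)) atBot (𝓝 (u y))

/-- h is the partial hodograph transform of (ψ, η):  ψ(q, h(q,p)) = p. -/
def Hodo (ψ : ℝ × ℝ → ℝ) (η : ℝ → ℝ) (h : ℝ → ℝ → ℝ) : Prop :=
  ∀ q : ℝ, ∀ p ∈ Icc (0:ℝ) 1, 0 ≤ h q p ∧ h q p ≤ η q ∧ ψ (q, h q p) = p

/-- h_q. -/
def hQ (h : ℝ → ℝ → ℝ) (q p : ℝ) : ℝ := deriv (fun q' => h q' p) q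

/-- h_p. -/
def hP (h : ℝ → ℝ → ℝ) (q p : ℝ) : ℝ := deriv (fun p' => h q p') p

/-- The flow force invariant s(ψ, η) evaluated at the abscissa x. -/
def fForce (ω : ℝ → ℝ) (r : ℝ) (ψ : ℝ × ℝ → ℝ) (η : ℝ → ℝ) (x : ℝ) : ℝ :=
  (r + 2 / 3 * Om ω 1) * η x -
    1 / 3 * (η x ^ 2 -
      ∫ y in (0:ℝ)..η x,
        (py η ψ (x, y) ^ 2 - px η ψ (x, y) ^ 2 - 2 * Om ω (ψ (x, y))))

/-- The flow force of the stream solution with parameter λ. -/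
def sStream (ω : ℝ → ℝ) (r lam : ℝ) : ℝ :=
  (r + 2 / 3 * Om ω 1) * dep ω lam -
    1 / 3 * (dep ω lam ^ 2 -
      ∫ p in (0:ℝ)..1, ((Hp ω lam p)⁻¹ - 2 * Om ω p * Hp ω lam p))

/-- (μ, φ) is an eigenpair of the Sturm–Liouville problem
−(H_p^{−3} φ′)′ = μ H_p^{−1} φ, φ(0) = 0, φ′(1) = H_p³(1) φ(1). -/
def EigenPair (ω : ℝ → ℝ) (lam μ : ℝ) (φ φ' : ℝ → ℝ) : Prop :=
  (∃ p ∈ Icc (0:ℝ) 1, φ p ≠ 0) ∧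
  (∀ p ∈ Icc (0:ℝ) 1, HasDerivWithinAt φ (φ' p) (Icc (0:ℝ) 1) p) ∧
  (∀ p ∈ Icc (0:ℝ) 1,
    HasDerivWithinAt (fun t => (Hp ω lam t)⁻¹ ^ 3 * φ' t)
      (-(μ * (Hp ω lam p)⁻¹ * φ p)) (Icc (0:ℝ) 1) p) ∧
  φ 0 = 0 ∧ φ' 1 = Hp ω lam 1 ^ 3 * φ 1

def IsEigen (ω : ℝ → ℝ) (lam μ : ℝ) : Prop := ∃ φ φ', EigenPair ω lam μ φ φ'

/-- μ0 is the least eigenvalue, with eigenfunction φ0. -/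
def Ground (ω : ℝ → ℝ) (lam μ0 : ℝ) (φ0 φ0' : ℝ → ℝ) : Prop :=
  IsLeast {μ : ℝ | IsEigen ω lam μ} μ0 ∧ EigenPair ω lam μ0 φ0 φ0'

/-- Normalisation ∫₀¹ φ0² H_p^{-1} dp = 1. -/
def Normalized (ω : ℝ → ℝ) (lam : ℝ) (φ0 : ℝ → ℝ) : Prop :=
  (∫ p in (0:ℝ)..1, φ0 p ^ 2 * (Hp ω lam p)⁻¹) = 1

/-- Weighted norm squared ‖u‖²_{θ,q₀} for functions on ℝ. -/
def wn1 (θ q0 : ℝ) (u : ℝ → ℝ) : ℝ :=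
  ∫ q : ℝ, u q ^ 2 * Real.exp (-θ * |q - q0|)

/-- Weighted norm squared ‖u‖²_{θ,q₀} for functions on S = ℝ × (0,1). -/
def wn2 (θ q0 : ℝ) (u : ℝ → ℝ → ℝ) : ℝ :=
  ∫ q : ℝ, (∫ p in (0:ℝ)..1, u q p ^ 2) * Real.exp (-θ * |q - q0|)

/-- The closed strip S̄ = ℝ × [0,1]. -/
def Sbar : Set (ℝ × ℝ) := (univ : Set ℝ) ×ˢ Icc (0:ℝ) 1

/-- a bounds the C²(S̄)-norm of u. -/
def C2Bound (u : ℝ × ℝ → ℝ) (a : ℝ) : Prop :=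
  ∀ z ∈ Sbar, ∀ n : ℕ, n ≤ 2 → ‖iteratedFDerivWithin ℝ n u Sbar z‖ ≤ a

/-- a bounds the C¹(S̄)-norm of u. -/
def C1Bound (u : ℝ × ℝ → ℝ) (a : ℝ) : Prop :=
  ∀ z ∈ Sbar, ∀ n : ℕ, n ≤ 1 → ‖iteratedFDerivWithin ℝ n u Sbar z‖ ≤ a

/-- ξ₀(q) = ∫₀¹ ξ(q,p) φ₀(p) H_p^{-1}(p) dp, the fundamental-mode projection. -/
def xiProj (ω : ℝ → ℝ) (lam : ℝ) (φ0 : ℝ → ℝ) (ξ : ℝ → ℝ → ℝ) (q : ℝ) : ℝ :=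
  ∫ p in (0:ℝ)..1, ξ q p * φ0 p * (Hp ω lam p)⁻¹

/-- ζ₀(q) = ∫₀¹ ζ(q,p) φ₀(p) dp. -/
def zetaProj (φ0 : ℝ → ℝ) (ζ : ℝ → ℝ → ℝ) (q : ℝ) : ℝ :=
  ∫ p in (0:ℝ)..1, ζ q p * φ0 p

/-- A smooth radial bump `Φ` supported in the unit ball, with `∇Φ z = -G z • z`, `0 ≤ G`. -/
lemma exists_radial_bump : ∃ Φ G : ℝ × ℝ → ℝ, ContDiff ℝ (⊤ : ℕ∞) Φ ∧ Continuous G ∧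
    (∀ z, 0 ≤ Φ z) ∧ (∀ z, 0 ≤ G z) ∧ 0 < Φ 0 ∧
    (∀ z, 1 < ‖z‖ → Φ z = 0) ∧ (∀ z, 1 < ‖z‖ → G z = 0) ∧
    ∀ z, fderiv ℝ Φ z (1, 0) = -(G z * z.1) ∧ fderiv ℝ Φ z (0, 1) = -(G z * z.2) := by
  set γ : ℝ → ℝ := fun s => expNegInvGlue (1 - s) with hγ
  have hγs : ContDiff ℝ (⊤ : ℕ∞) γ := expNegInvGlue.contDiff.comp (contDiff_const.sub contDiff_id)
  have hanti : Antitone γ := fun s t hst => expNegInvGlue.monotone (by linarith)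
  have hγd : Continuous (deriv γ) := hγs.continuous_deriv (by simp)
  have hzero : ∀ s, 1 ≤ s → γ s = 0 := fun s hs => expNegInvGlue.zero_of_nonpos (by linarith)
  have hdzero : ∀ s, 1 ≤ s → deriv γ s = 0 := fun s hs =>
    IsLocalMin.deriv_eq_zero (Filter.Eventually.of_forall fun t => by
      rw [hzero s hs]; exact expNegInvGlue.nonneg _)
  have hnorm : ∀ z : ℝ × ℝ, 1 < ‖z‖ → 1 ≤ z.1 ^ 2 + z.2 ^ 2 := by
    intro z hz
    rw [Prod.norm_def, lt_max_iff, Real.norm_eq_abs, Real.norm_eq_abs] at hz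
    rcases hz with h | h
    · nlinarith [sq_abs z.1, sq_nonneg z.2]
    · nlinarith [sq_abs z.2, sq_nonneg z.1]
  refine ⟨fun z => γ (z.1 ^ 2 + z.2 ^ 2), fun z => -2 * deriv γ (z.1 ^ 2 + z.2 ^ 2),
    hγs.comp ((contDiff_fst.pow 2).add (contDiff_snd.pow 2)), by fun_prop,
    fun z => expNegInvGlue.nonneg _, fun z => ?_, expNegInvGlue.pos_of_pos (by simp),
    fun z hz => hzero _ (hnorm z hz), fun z hz => by simp [hdzero _ (hnorm z hz)], fun z => ?_⟩
  · have := hanti.deriv_nonpos (x := z.1 ^ 2 + z.2 ^ 2)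
    linarith
  · have h1 : HasDerivAt γ (deriv γ (z.1 ^ 2 + z.2 ^ 2)) (z.1 ^ 2 + z.2 ^ 2) :=
      (hγs.differentiable (by simp) _).hasDerivAt
    have h2 := h1.comp_hasFDerivAt z
      (((hasFDerivAt_fst (𝕜 := ℝ) (p := z)).pow 2).add ((hasFDerivAt_snd (𝕜 := ℝ) (p := z)).pow 2))
    have h3 := h2.fderiv
    simp only [Function.comp_def, Pi.add_apply] at h3
    rw [h3]
    constructor <;> simp <;> ring

/-- A `C¹` function which is strictly superharmonic in the weak sense has no local minimum. -/
lemma not_isLocalMin_of_weak_superharmonic {U : Set (ℝ × ℝ)} (hU : IsOpen U) {v : ℝ × ℝ → ℝ}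
    {v' : ℝ × ℝ → (ℝ × ℝ →L[ℝ] ℝ)} (hv : ∀ z ∈ U, HasFDerivAt v (v' z) z)
    (hv' : ContinuousOn v' U) {z₀ : ℝ × ℝ} (hz₀ : z₀ ∈ U)
    (hw : ∀ φ : ℝ × ℝ → ℝ, ContDiff ℝ (⊤ : ℕ∞) φ → HasCompactSupport φ → tsupport φ ⊆ U →
      (∀ z, 0 ≤ φ z) → 0 < φ z₀ →
      0 < ∫ z, (v' z (1, 0) * fderiv ℝ φ z (1, 0) + v' z (0, 1) * fderiv ℝ φ z (0, 1))) :
    ¬ IsLocalMin v z₀ := by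
  intro hmin
  obtain ⟨Φ, G, hΦ, hG, hΦ0, hG0, hΦpos, hΦz, hGz, hgrad⟩ := exists_radial_bump
  obtain ⟨R, hR, hball⟩ := Metric.nhds_basis_closedBall.mem_iff.1
    (Filter.inter_mem (hU.mem_nhds hz₀) hmin)
  have hBU : Metric.closedBall z₀ R ⊆ U := fun z hz => (hball hz).1
  have hBm : ∀ z ∈ Metric.closedBall z₀ R, v z₀ ≤ v z := fun z hz => (hball hz).2
  set B : Set (ℝ × ℝ) := Metric.closedBall 0 1 with hB
  have hBc : IsCompact B := isCompact_closedBall _ _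
  have hBms : MeasurableSet B := Metric.isClosed_closedBall.measurableSet
  have hmem : ∀ t ∈ Ioo (-R) R, ∀ z ∈ B, z₀ + t • z ∈ Metric.closedBall z₀ R := by
    intro t ht z hz
    rw [hB, mem_closedBall_zero_iff] at hz
    rw [mem_closedBall_iff_norm, add_sub_cancel_left, norm_smul, Real.norm_eq_abs]
    have := abs_lt.2 ht
    nlinarith [abs_nonneg t, norm_nonneg z]
  have hvc : ContinuousOn v U := fun z hz => (hv z hz).continuousAt.continuousWithinAt
  obtain ⟨C, hC⟩ := ((isCompact_closedBall z₀ R).exists_bound_of_continuousOn (hv'.mono hBU))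
  obtain ⟨C', hC'⟩ := hBc.exists_bound_of_continuousOn hG.continuousOn
  have hC0 : 0 ≤ C := (norm_nonneg _).trans (hC z₀ (Metric.mem_closedBall_self hR.le))
  have hC'0 : 0 ≤ C' := (norm_nonneg _).trans (hC' 0 (Metric.mem_closedBall_self zero_le_one))
  have hcont1 : ∀ t ∈ Ioo (-R) R, ContinuousOn (fun z => v (z₀ + t • z) * G z) B := fun t ht =>
    (hvc.comp (by fun_prop) (fun z hz => hBU (hmem t ht z hz))).mul hG.continuousOn
  have hcont2 : ∀ t ∈ Ioo (-R) R, ContinuousOn (fun z => v' (z₀ + t • z) z * G z) B := fun t ht =>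
    ((hv'.comp (by fun_prop) (fun z hz => hBU (hmem t ht z hz))).clm_apply continuousOn_id).mul
      hG.continuousOn
  set A : ℝ → ℝ := fun t => ∫ z in B, v (z₀ + t • z) * G z with hA
  have hderiv : ∀ t ∈ Ioo (-R) R, HasDerivAt A (∫ z in B, v' (z₀ + t • z) z * G z) t := by
    intro t ht
    refine (hasDerivAt_integral_of_dominated_loc_of_deriv_le (μ := volume.restrict B)
      (F := fun t z => v (z₀ + t • z) * G z) (F' := fun t z => v' (z₀ + t • z) z * G z)
      (s := Ioo (-R) R) (bound := fun _ => C * 1 * C') (isOpen_Ioo.mem_nhds ht) ?_ ?_ ?_ ?_ ?_ ?_).2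
    · filter_upwards [isOpen_Ioo.mem_nhds ht] with s hs
      exact (hcont1 s hs).aestronglyMeasurable hBms
    · exact (hcont1 t ht).integrableOn_compact hBc
    · exact (hcont2 t ht).aestronglyMeasurable hBms
    · filter_upwards [ae_restrict_mem hBms] with z hz s hs
      rw [norm_mul]
      have hz1 : ‖z‖ ≤ 1 := mem_closedBall_zero_iff.1 hz
      have h1 : ‖v' (z₀ + s • z) z‖ ≤ C * 1 :=
        ((v' (z₀ + s • z)).le_opNorm z).trans
          (mul_le_mul (hC _ (hmem s hs z hz)) hz1 (norm_nonneg _) hC0)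
      exact mul_le_mul h1 (hC' z hz) (norm_nonneg _) (by positivity)
    · exact integrableOn_const hBc.measure_lt_top.ne
    · filter_upwards [ae_restrict_mem hBms] with z hz s hs
      have h1 : HasDerivAt (fun s : ℝ => z₀ + s • z) z s := by
        simpa using ((hasDerivAt_id s).smul_const z).const_add z₀
      exact ((hv _ (hBU (hmem s hs z hz))).comp_hasDerivAt s h1).mul_const _
  have hneg : ∀ t ∈ Ioo 0 R, (∫ z in B, v' (z₀ + t • z) z * G z) < 0 := by
    intro t ht
    have ht0 : 0 < t := ht.1
    set φ : ℝ × ℝ → ℝ := fun w => Φ (t⁻¹ • (w - z₀)) with hφ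
    have hφs : Function.support φ ⊆ Metric.closedBall z₀ t := by
      intro w hw
      by_contra hwt
      rw [mem_closedBall_iff_norm, not_le] at hwt
      refine hw (hΦz _ ?_)
      rw [norm_smul, Real.norm_eq_abs, abs_of_pos (inv_pos.2 ht0)]
      field_simp
      exact hwt
    have hφf : ∀ w u, fderiv ℝ φ w u = t⁻¹ * fderiv ℝ Φ (t⁻¹ • (w - z₀)) u := by
      intro w u
      have h1 : HasFDerivAt (fun w : ℝ × ℝ => t⁻¹ • (w - z₀))
          (t⁻¹ • ContinuousLinearMap.id ℝ (ℝ × ℝ)) w :=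
        ((hasFDerivAt_id w).sub_const z₀).const_smul t⁻¹
      have h2 := ((hΦ.differentiable (by simp) _).hasFDerivAt.comp w h1).fderiv
      rw [hφ]
      rw [Function.comp_def] at h2
      rw [h2]
      simp
    have hpos := hw φ (hΦ.comp (g := Φ) (f := fun w => t⁻¹ • (w - z₀)) (by fun_prop))
      (HasCompactSupport.of_support_subset_isCompact (isCompact_closedBall z₀ t) hφs)
      ((closure_minimal hφs Metric.isClosed_closedBall).trans
        ((Metric.closedBall_subset_closedBall ht.2.le).trans hBU))
      (fun z => hΦ0 _) (by simpa [hφ] using hΦpos)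
    set f : ℝ × ℝ → ℝ := fun z =>
      v' z (1, 0) * fderiv ℝ φ z (1, 0) + v' z (0, 1) * fderiv ℝ φ z (0, 1) with hf
    have hfz : ∀ z, v' (z₀ + t • z) z * G z = -t * f (z₀ + t • z) := by
      intro z
      have e : t⁻¹ • (z₀ + t • z - z₀) = z := by
        rw [add_sub_cancel_left, smul_smul, inv_mul_cancel₀ ht0.ne', one_smul]
      have hlin : ∀ T : ℝ × ℝ →L[ℝ] ℝ, T z = z.1 * T (1, 0) + z.2 * T (0, 1) := fun T => by
        have hz : z = z.1 • ((1 : ℝ), (0 : ℝ)) + z.2 • ((0 : ℝ), (1 : ℝ)) := by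
          ext <;> simp
        conv_lhs => rw [hz]
        simp only [map_add, map_smul, smul_eq_mul]
      simp only [hf, hφf, e, (hgrad z).1, (hgrad z).2]
      rw [hlin]
      field_simp
      ring
    rw [setIntegral_eq_integral_of_forall_compl_eq_zero
      (fun z hz => by rw [hGz z (by simpa [hB] using hz), mul_zero])]
    simp only [hfz]
    rw [integral_const_mul, Measure.integral_comp_smul volume (fun z => f (z₀ + z)) t,
      integral_add_left_eq_self f z₀, smul_eq_mul]
    have h3 : 0 < |(t ^ Module.finrank ℝ (ℝ × ℝ))⁻¹| := by positivity
    have := mul_pos ht0 (mul_pos h3 hpos)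
    linarith
  have hsub : Icc 0 (R / 2) ⊆ Ioo (-R) R := fun s hs => ⟨by linarith [hs.1], by linarith [hs.2]⟩
  have hstrict : StrictAntiOn A (Icc 0 (R / 2)) := by
    refine strictAntiOn_of_deriv_neg (convex_Icc _ _)
      (fun s hs => (hderiv s (hsub hs)).continuousAt.continuousWithinAt) fun s hs => ?_
    rw [interior_Icc] at hs
    rw [(hderiv s (hsub (Ioo_subset_Icc_self hs))).deriv]
    exact hneg s ⟨hs.1, by linarith [hs.2]⟩
  have hlt : A (R / 2) < A 0 :=
    hstrict ⟨le_rfl, by positivity⟩ ⟨by positivity, le_rfl⟩ (by positivity)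
  have hR2 : R / 2 ∈ Ioo (-R) R := hsub ⟨by positivity, le_rfl⟩
  have h0 : (0 : ℝ) ∈ Ioo (-R) R := hsub ⟨le_rfl, by positivity⟩
  refine absurd hlt (not_lt.2 ?_)
  refine setIntegral_mono_on ((hcont1 0 h0).integrableOn_compact hBc)
    ((hcont1 _ hR2).integrableOn_compact hBc) hBms fun z hz => ?_
  refine mul_le_mul_of_nonneg_right ?_ (hG0 z)
  rw [zero_smul, add_zero]
  exact hBm _ (hmem _ hR2 z hz)

lemma isOpen_dom {η : ℝ → ℝ} (hη : Continuous η) : IsOpen (dom η) :=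
  (isOpen_lt continuous_const continuous_snd).inter
    (isOpen_lt continuous_snd (hη.comp continuous_fst))

lemma isClosed_domc {η : ℝ → ℝ} (hη : Continuous η) : IsClosed (domc η) :=
  (isClosed_le continuous_const continuous_snd).inter
    (isClosed_le continuous_snd (hη.comp continuous_fst))

lemma dom_subset_domc (η : ℝ → ℝ) : dom η ⊆ domc η := fun _ hz => ⟨hz.1.le, hz.2.le⟩

section Solution

variable {ω : ℝ → ℝ} {M r : ℝ} {ψ : ℝ × ℝ → ℝ} {η : ℝ → ℝ}

lemma Sol.hasDerivWithinAt_vertical (h : Sol ω M r ψ η) {x y : ℝ} (hy : y ∈ Icc 0 (η x)) :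
    HasDerivWithinAt (fun t => ψ (x, t)) (py η ψ (x, y)) (Icc 0 (η x)) y := by
  have h1 : HasDerivWithinAt (fun t : ℝ => (x, t)) ((0 : ℝ), (1 : ℝ)) (Icc 0 (η x)) y :=
    ((hasDerivAt_const y x).prodMk (hasDerivAt_id y)).hasDerivWithinAt
  have h2 := (h.smooth.differentiableOn one_ne_zero (x, y) hy).hasFDerivWithinAt
  exact h2.comp_hasDerivWithinAt y h1 fun t ht => ht

lemma Sol.strictMonoOn_vertical (h : Sol ω M r ψ η) (x : ℝ) :
    StrictMonoOn (fun t => ψ (x, t)) (Icc 0 (η x)) := by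
  refine strictMonoOn_of_deriv_pos (convex_Icc _ _)
    (fun y hy => (h.hasDerivWithinAt_vertical hy).continuousWithinAt) fun y hy => ?_
  rw [interior_Icc] at hy
  rw [((h.hasDerivWithinAt_vertical (Ioo_subset_Icc_self hy)).hasDerivAt
    (Icc_mem_nhds hy.1 hy.2)).deriv]
  exact h.unidir (x, y) ⟨hy.1.le, hy.2.le⟩

lemma Sol.mem_Icc (h : Sol ω M r ψ η) {z : ℝ × ℝ} (hz : z ∈ domc η) : ψ z ∈ Icc (0 : ℝ) 1 := by
  have hm := (h.strictMonoOn_vertical z.1).monotoneOn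
  have h0 := (h.eta_pos z.1).le
  constructor
  · rw [← h.bottom z.1]
    exact hm ⟨le_rfl, h0⟩ hz hz.1
  · rw [← h.surface z.1]
    exact hm hz ⟨h0, le_rfl⟩ hz.2

lemma Sol.hasFDerivAt (h : Sol ω M r ψ η) {z : ℝ × ℝ} (hz : z ∈ dom η) :
    HasFDerivAt ψ (fderiv ℝ ψ z) z :=
  (((h.smooth.differentiableOn one_ne_zero) z (dom_subset_domc η hz)).differentiableAt
    (mem_of_superset ((isOpen_dom h.eta_lip.continuous).mem_nhds hz)
      (dom_subset_domc η))).hasFDerivAt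

lemma Sol.fderivWithin_eq (h : Sol ω M r ψ η) {z : ℝ × ℝ} (hz : z ∈ dom η) :
    fderivWithin ℝ ψ (domc η) z = fderiv ℝ ψ z :=
  fderivWithin_of_mem_nhds (mem_of_superset ((isOpen_dom h.eta_lip.continuous).mem_nhds hz)
    (dom_subset_domc η))

lemma Sol.continuousOn_fderiv (h : Sol ω M r ψ η) : ContinuousOn (fderiv ℝ ψ) (dom η) :=
  (h.smooth.mono (dom_subset_domc η)).continuousOn_fderiv_of_isOpen
    (isOpen_dom h.eta_lip.continuous) le_rfl

lemma abs_le_om0 (hω : ContinuousOn ω (Icc 0 1)) {p : ℝ} (hp : p ∈ Icc (0 : ℝ) 1) :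
    |ω p| ≤ om0 ω :=
  le_csSup (isCompact_Icc.image_of_continuousOn hω.abs).bddAbove ⟨p, hp, rfl⟩

lemma fderiv_eq_zero_of_notMem {φ : ℝ × ℝ → ℝ} {U : Set (ℝ × ℝ)} (hφ : tsupport φ ⊆ U)
    {z : ℝ × ℝ} (hz : z ∉ U) : fderiv ℝ φ z = 0 :=
  Function.notMem_support.1 fun h => hz (hφ (support_fderiv_subset ℝ h))

/-- Weakly, `-Δψ ≤ ω₀`. -/
lemma Sol.weak_le (h : Sol ω M r ψ η) (hω : ContinuousOn ω (Icc 0 1)) {φ : ℝ × ℝ → ℝ}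
    (hφ : ContDiff ℝ (⊤ : ℕ∞) φ) (hc : HasCompactSupport φ) (hs : tsupport φ ⊆ dom η)
    (h0 : ∀ z, 0 ≤ φ z) :
    ∫ z, (fderiv ℝ ψ z (1, 0) * fderiv ℝ φ z (1, 0) +
      fderiv ℝ ψ z (0, 1) * fderiv ℝ φ z (0, 1)) ≤ om0 ω * ∫ z, φ z := by
  have hms : MeasurableSet (dom η) := (isOpen_dom h.eta_lip.continuous).measurableSet
  have hω0 : 0 ≤ om0 ω := (abs_nonneg _).trans (abs_le_om0 hω ⟨le_rfl, zero_le_one⟩)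
  have hφz : ∀ z, z ∉ dom η → φ z = 0 := fun z hz =>
    image_eq_zero_of_notMem_tsupport fun h' => hz (hs h')
  have hφi : Integrable φ := hφ.continuous.integrable_of_hasCompactSupport hc
  have hw := h.weak φ hφ hc hs
  have e1 : ∫ z in dom η,
      (px η ψ z * fderiv ℝ φ z (1, 0) + py η ψ z * fderiv ℝ φ z (0, 1)) =
      ∫ z, (fderiv ℝ ψ z (1, 0) * fderiv ℝ φ z (1, 0) +
      fderiv ℝ ψ z (0, 1) * fderiv ℝ φ z (0, 1)) := by
    refine (setIntegral_congr_fun hms fun z hz => ?_).trans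
      (setIntegral_eq_integral_of_forall_compl_eq_zero fun z hz => ?_)
    · simp only [px, py, h.fderivWithin_eq hz]
    · simp [fderiv_eq_zero_of_notMem hs hz]
  rw [← e1, hw, ← setIntegral_eq_integral_of_forall_compl_eq_zero (s := dom η) hφz,
    ← integral_const_mul]
  by_cases hi : IntegrableOn (fun z => ω (ψ z) * φ z) (dom η)
  · exact setIntegral_mono_on hi (hφi.integrableOn.const_mul _) hms fun z hz =>
      mul_le_mul_of_nonneg_right
        ((le_abs_self _).trans (abs_le_om0 hω (h.mem_Icc (dom_subset_domc η hz)))) (h0 z)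
  · rw [integral_undef hi]
    exact integral_nonneg fun z => mul_nonneg hω0 (h0 z)

/-- The quadratic comparison function `a y - b y² / 2 + e (x - x₁)²`. -/
def barrier (a b e x₁ : ℝ) (z : ℝ × ℝ) : ℝ := a * z.2 - b / 2 * z.2 ^ 2 + e * (z.1 - x₁) ^ 2

/-- The derivative of `barrier`. -/
def barrier' (a b e x₁ : ℝ) (z : ℝ × ℝ) : ℝ × ℝ →L[ℝ] ℝ :=
  (2 * e * (z.1 - x₁)) • ContinuousLinearMap.fst ℝ ℝ ℝ +
    (a - b * z.2) • ContinuousLinearMap.snd ℝ ℝ ℝ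

lemma hasFDerivAt_barrier (a b e x₁ : ℝ) (z : ℝ × ℝ) :
    HasFDerivAt (barrier a b e x₁) (barrier' a b e x₁ z) z := by
  have h1 := hasFDerivAt_fst (𝕜 := ℝ) (p := z)
  have h2 := hasFDerivAt_snd (𝕜 := ℝ) (p := z)
  have h3 := ((h2.const_mul a).sub ((h2.pow 2).const_mul (b / 2))).add
    (((h1.sub_const x₁).pow 2).const_mul e)
  refine h3.congr_fderiv ?_
  ext <;> simp [barrier'] <;> ring

/-- `-Δ (barrier) = b - 2 e` in the weak sense. -/
lemma integral_barrier (a b e x₁ : ℝ) {φ : ℝ × ℝ → ℝ}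
    (hφ : ContDiff ℝ (⊤ : ℕ∞) φ) (hc : HasCompactSupport φ) :
    ∫ z, (barrier' a b e x₁ z (1, 0) * fderiv ℝ φ z (1, 0) +
      barrier' a b e x₁ z (0, 1) * fderiv ℝ φ z (0, 1)) = (b - 2 * e) * ∫ z, φ z := by
  have hφd : Differentiable ℝ φ := hφ.differentiable (by simp)
  have hint : ∀ f : ℝ × ℝ → ℝ, Continuous f → Integrable fun z => f z * φ z := fun f hf =>
    (hf.mul hφ.continuous).integrable_of_hasCompactSupport hc.mul_left
  have hint' : ∀ (f : ℝ × ℝ → ℝ) (u : ℝ × ℝ), Continuous f →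
      Integrable fun z => f z * fderiv ℝ φ z u := fun f u hf =>
    Continuous.integrable_of_hasCompactSupport
      (hf.mul ((hφ.continuous_fderiv (by simp)).clm_apply continuous_const)) (hc.fderiv_apply ℝ u).mul_left
  have key : ∀ (f : ℝ × ℝ → ℝ) (u : ℝ × ℝ) (c : ℝ), Differentiable ℝ f →
      (∀ z, fderiv ℝ f z u = c) → ∫ z, f z * fderiv ℝ φ z u = -c * ∫ z, φ z := by
    intro f u c hf hfc
    rw [integral_mul_fderiv_eq_neg_fderiv_mul_of_integrable
      (by simp only [hfc]; exact hint _ continuous_const) (hint' f u hf.continuous)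
      (hint f hf.continuous) (fun z _ => hf z) fun z _ => hφd z]
    simp only [hfc]
    rw [integral_const_mul, neg_mul]
  have hd1 : ∀ z : ℝ × ℝ, HasFDerivAt (fun z : ℝ × ℝ => 2 * e * (z.1 - x₁))
      ((2 * e) • ContinuousLinearMap.fst ℝ ℝ ℝ) z := fun z =>
    ((hasFDerivAt_fst (𝕜 := ℝ) (p := z)).sub_const x₁).const_mul (2 * e)
  have hd2 : ∀ z : ℝ × ℝ, HasFDerivAt (fun z : ℝ × ℝ => a - b * z.2)
      (-(b • ContinuousLinearMap.snd ℝ ℝ ℝ)) z := fun z =>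
    ((hasFDerivAt_snd (𝕜 := ℝ) (p := z)).const_mul b).const_sub a
  have k1 := key _ (1, 0) (2 * e) (fun z => (hd1 z).differentiableAt)
    fun z => by rw [(hd1 z).fderiv]; simp
  have k2 := key _ (0, 1) (-b) (fun z => (hd2 z).differentiableAt)
    fun z => by rw [(hd2 z).fderiv]; simp
  have e1 : ∀ z, barrier' a b e x₁ z (1, 0) = 2 * e * (z.1 - x₁) := fun z => by simp [barrier']
  have e2 : ∀ z, barrier' a b e x₁ z (0, 1) = a - b * z.2 := fun z => by simp [barrier']
  simp only [e1, e2]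
  rw [integral_add (hint' _ _ (by fun_prop)) (hint' _ _ (by fun_prop)), k1, k2]
  ring

lemma continuous_barrier' (a b e x₁ : ℝ) : Continuous (barrier' a b e x₁) := by
  unfold barrier'
  fun_prop

/-- `barrier - ψ` has no local minimum inside the fluid when `ω₀ < b - 2 e`. -/
lemma Sol.not_isLocalMin_barrier_sub (h : Sol ω M r ψ η) (hω : ContinuousOn ω (Icc 0 1))
    {a b e x₁ : ℝ} (hb : om0 ω < b - 2 * e) {z₀ : ℝ × ℝ} (hz₀ : z₀ ∈ dom η) :
    ¬ IsLocalMin (fun z => barrier a b e x₁ z - ψ z) z₀ := by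
  have hU := isOpen_dom h.eta_lip.continuous
  refine not_isLocalMin_of_weak_superharmonic hU
    (fun z hz => (hasFDerivAt_barrier a b e x₁ z).sub (h.hasFDerivAt hz))
    ((continuous_barrier' a b e x₁).continuousOn.sub h.continuousOn_fderiv) hz₀ ?_
  intro φ hφ hc hs h0 hφz
  have hφi : Integrable φ := hφ.continuous.integrable_of_hasCompactSupport hc
  have hpos : 0 < ∫ z, φ z :=
    hφ.continuous.integral_pos_of_hasCompactSupport_nonneg_nonzero hc h0 hφz.ne'
  have hcont : ∀ {f : ℝ × ℝ → (ℝ × ℝ →L[ℝ] ℝ)} (u : ℝ × ℝ), ContinuousOn f (dom η) →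
      Integrable fun z => f z u * fderiv ℝ φ z u := by
    intro f u hf
    have hφc : Continuous fun z => fderiv ℝ φ z u :=
      (hφ.continuous_fderiv (by simp)).clm_apply continuous_const
    have hsub : tsupport (fun z => f z u * fderiv ℝ φ z u) ⊆ tsupport φ :=
      (tsupport_mul_subset_right).trans (tsupport_fderiv_apply_subset ℝ u)
    refine Continuous.integrable_of_hasCompactSupport ?_ (hc.fderiv_apply ℝ u).mul_left
    refine continuous_of_tsupport fun z hz => ?_
    have hz' := hU.mem_nhds (hs (hsub hz))
    exact ((hf.continuousAt hz').clm_apply continuousAt_const).mul hφc.continuousAt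
  have hi : ∀ {f : ℝ × ℝ → (ℝ × ℝ →L[ℝ] ℝ)}, ContinuousOn f (dom η) → Integrable fun z =>
      f z (1, 0) * fderiv ℝ φ z (1, 0) + f z (0, 1) * fderiv ℝ φ z (0, 1) := fun hf =>
    (hcont _ hf).add (hcont _ hf)
  have e1 := integral_sub (hi (continuous_barrier' a b e x₁).continuousOn)
    (hi h.continuousOn_fderiv)
  rw [integral_barrier a b e x₁ hφ hc] at e1
  have e2 : ∀ z, (barrier' a b e x₁ z - fderiv ℝ ψ z) (1, 0) * fderiv ℝ φ z (1, 0) +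
      (barrier' a b e x₁ z - fderiv ℝ ψ z) (0, 1) * fderiv ℝ φ z (0, 1) =
      (barrier' a b e x₁ z (1, 0) * fderiv ℝ φ z (1, 0) +
        barrier' a b e x₁ z (0, 1) * fderiv ℝ φ z (0, 1)) -
      (fderiv ℝ ψ z (1, 0) * fderiv ℝ φ z (1, 0) +
        fderiv ℝ ψ z (0, 1) * fderiv ℝ φ z (0, 1)) := fun z => by
    simp only [sub_apply]; ring
  have e3 := h.weak_le hω hφ hc hs h0
  simp only [e2]
  rw [e1]
  nlinarith

/-- If the surface dips strictly below the level `d`, then the barrier bounds the speed from below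
at some surface point. -/
lemma Sol.exists_surface_slope_le (h : Sol ω M r ψ η) (hω : ContinuousOn ω (Icc 0 1))
    {b e d x₁ : ℝ} (he : 0 < e) (hd : 0 < d) (hb : om0 ω < b - 2 * e)
    (hbd : b * d ^ 2 ≤ 2) (hη : η x₁ < d) :
    ∃ x, η x < d ∧ 1 / d + b * d / 2 - b * η x ≤ py η ψ (x, η x) := by
  have hω0 : 0 ≤ om0 ω := (abs_nonneg _).trans (abs_le_om0 hω ⟨le_rfl, zero_le_one⟩)
  have hb0 : 0 < b := by linarith
  have hηc := h.eta_lip.continuous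
  set a : ℝ := 1 / d + b * d / 2 with ha
  have had : a * d = 1 + b * d ^ 2 / 2 := by rw [ha]; field_simp
  have hbda : b * d ≤ a := by
    have : b * d / 2 ≤ 1 / d := by rw [div_le_div_iff₀ two_pos hd]; linarith
    linarith
  set F := barrier a b e x₁ with hF
  obtain ⟨L, hL, heL⟩ : ∃ L : ℝ, 0 < L ∧ e * L ^ 2 = 1 :=
    ⟨(√e)⁻¹, by positivity, by rw [inv_pow, Real.sq_sqrt he.le, mul_inv_cancel₀ he.ne']⟩
  have hline : ∀ y ∈ Icc 0 d, 0 ≤ a * y - b / 2 * y ^ 2 := fun y hy => by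
    have h1 : 0 ≤ a - b / 2 * y := by nlinarith [hy.1, hy.2]
    nlinarith [mul_nonneg hy.1 h1]
  set K : Set (ℝ × ℝ) := (Icc (x₁ - L) (x₁ + L) ×ˢ Icc 0 d) ∩ domc η with hK
  have hKc : IsCompact K := (isCompact_Icc.prod isCompact_Icc).inter_right (isClosed_domc hηc)
  have hcont : ContinuousOn (fun z => F z - ψ z) K :=
    (continuous_iff_continuousAt.2 fun z =>
      (hasFDerivAt_barrier a b e x₁ z).continuousAt).continuousOn.sub
      (h.smooth.continuousOn.mono inter_subset_right)
  have hz₁ : (x₁, η x₁) ∈ K :=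
    ⟨⟨⟨by simp [hL.le], by simp [hL.le]⟩, (h.eta_pos x₁).le, hη.le⟩, (h.eta_pos x₁).le, le_rfl⟩
  obtain ⟨z, hz, hzmin⟩ := hKc.exists_isMinOn ⟨_, hz₁⟩ hcont
  have hneg : F z < ψ z := by
    have h1 : F z - ψ z ≤ F (x₁, η x₁) - ψ (x₁, η x₁) := hzmin hz₁
    have h2 : F (x₁, η x₁) < 1 := by
      have h3 : 0 < a - b / 2 * (d + η x₁) := by
        have := mul_lt_mul_of_pos_left hη hb0
        linarith
      have := mul_pos (sub_pos.2 hη) h3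
      simp only [hF, barrier, sub_self]
      nlinarith
    rw [h.surface] at h1
    linarith
  obtain ⟨x, y⟩ := z
  obtain ⟨⟨hx, hy⟩, hzD⟩ := hz
  simp only at hx hy
  have hψ := h.mem_Icc hzD
  have hFval : F (x, y) = a * y - b / 2 * y ^ 2 + e * (x - x₁) ^ 2 := rfl
  have hl := hline y hy
  have hxsq : 0 ≤ e * (x - x₁) ^ 2 := by positivity
  have hy0 : 0 < y := by
    refine lt_of_le_of_ne hy.1 fun h0 => ?_
    subst h0
    rw [h.bottom] at hneg
    linarith
  have hyd : y < d := by
    refine lt_of_le_of_ne hy.2 fun h0 => ?_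
    subst h0
    linarith [hψ.2]
  have hxL : x ∈ Ioo (x₁ - L) (x₁ + L) := by
    have h1 : (x - x₁) ^ 2 < L ^ 2 := by
      by_contra! hcon
      have := mul_le_mul_of_nonneg_left hcon he.le
      linarith [hψ.2]
    have h2 := abs_lt_of_sq_lt_sq' h1 hL.le
    exact ⟨by linarith [h2.1], by linarith [h2.2]⟩
  have hyη : y = η x := by
    refine le_antisymm hzD.2 (not_lt.1 fun hlt => ?_)
    refine h.not_isLocalMin_barrier_sub hω hb (a := a) (x₁ := x₁) (z₀ := (x, y)) ⟨hy0, hlt⟩ ?_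
    refine hzmin.isLocalMin ?_
    refine Filter.inter_mem (prod_mem_nhds (Icc_mem_nhds hxL.1 hxL.2) (Icc_mem_nhds hy0 hyd)) ?_
    exact mem_of_superset ((isOpen_dom hηc).mem_nhds ⟨hy0, hlt⟩) (dom_subset_domc η)
  subst hyη
  refine ⟨x, hyd, ?_⟩
  have hFd : HasDerivAt (fun t => F (x, t)) (a - b * η x) (η x) := by
    have := (hasFDerivAt_barrier a b e x₁ (x, η x)).comp_hasDerivAt (η x)
      ((hasDerivAt_const (η x) x).prodMk (hasDerivAt_id (η x)))
    refine this.congr_deriv ?_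
    simp [barrier']
  have hmem : η x ∈ Icc 0 (η x) := ⟨hy0.le, le_rfl⟩
  have hderiv := hFd.hasDerivWithinAt.sub (h.hasDerivWithinAt_vertical hmem)
  have hmin : IsMinOn (fun t => F (x, t) - ψ (x, t)) (Icc 0 (η x)) (η x) := fun t ht =>
    hzmin ⟨⟨hx, ht.1, ht.2.trans hyd.le⟩, ht⟩
  have hcone : (-(η x) : ℝ) ∈ posTangentConeAt (Icc 0 (η x)) (η x) := by
    refine mem_posTangentConeAt_of_segment_subset ?_
    rw [add_neg_cancel, segment_symm, segment_eq_Icc hy0.le]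
  have := hmin.localize.hasFDerivWithinAt_nonneg hderiv.hasFDerivWithinAt hcone
  simp at this
  nlinarith

end Solution

/-- Lemma 4.1 (lower bound for the depth). -/
theorem statement5
    (ω : ℝ → ℝ) (K : NNReal) (hω : LipschitzOnWith K ω (Icc (0:ℝ) 1))
    (lamc rc : ℝ) (hc : Crit ω lamc rc) :
    ∀ M r : ℝ, 0 < M → rc < r →
      ∀ (ψ : ℝ × ℝ → ℝ) (η : ℝ → ℝ), Sol ω M r ψ η →
        ∀ x : ℝ,
          min (Real.sqrt (6 * r))⁻¹ (Real.sqrt (2 * om0 ω))⁻¹ ≤ η x := by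
  intro M r _ _ ψ η h x₁
  have hωc : ContinuousOn ω (Icc 0 1) := hω.continuousOn
  by_contra! hη
  set d := min (Real.sqrt (6 * r))⁻¹ (Real.sqrt (2 * om0 ω))⁻¹ with hd
  have hd0 : 0 < d := (h.eta_pos x₁).trans hη
  have sq_bound : ∀ s : ℝ, d ≤ (Real.sqrt s)⁻¹ → s * d ^ 2 ≤ 1 := by
    intro s hs
    have hs0 : 0 < Real.sqrt s := inv_pos.1 (hd0.trans_le hs)
    have h1 : d * Real.sqrt s ≤ 1 := by
      rwa [← one_div, le_div_iff₀ hs0] at hs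
    have h2 : (d * Real.sqrt s) ^ 2 ≤ 1 := pow_le_one₀ (by positivity) h1
    rw [mul_pow, Real.sq_sqrt (Real.sqrt_pos.1 hs0).le] at h2
    linarith
  have hr := sq_bound _ (min_le_left _ _)
  have ho := sq_bound _ (min_le_right _ _)
  set e : ℝ := 1 / (100 * d ^ 2) with he
  have he0 : 0 < e := by positivity
  have hed : e * d ^ 2 = 1 / 100 := by rw [he]; field_simp
  have hbd : (om0 ω + 4 * e) * d ^ 2 ≤ 27 / 50 := by nlinarith
  have hω0 : 0 ≤ om0 ω := (abs_nonneg _).trans (abs_le_om0 hωc ⟨le_rfl, zero_le_one⟩)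
  obtain ⟨x, hxd, hx⟩ := h.exists_surface_slope_le hωc (b := om0 ω + 4 * e) he0 hd0
    (by linarith) (by linarith) hη
  have hb := h.bern x
  have hηx := h.eta_pos x
  set p := py η ψ (x, η x) with hp
  have h1 : 73 / 100 ≤ p * d := by
    have h2 : (om0 ω + 4 * e) * η x ≤ (om0 ω + 4 * e) * d :=
      mul_le_mul_of_nonneg_left hxd.le (by positivity)
    have h3 : 1 / d - (om0 ω + 4 * e) * d / 2 ≤ p := by linarith
    have h4 := mul_le_mul_of_nonneg_right h3 hd0.le
    have h5 : (1 / d - (om0 ω + 4 * e) * d / 2) * d = 1 - (om0 ω + 4 * e) * d ^ 2 / 2 := by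
      field_simp
    linarith
  have h2 : p ^ 2 < 3 * r := by nlinarith [sq_nonneg (px η ψ (x, η x))]
  have h3 := mul_lt_mul_of_pos_right h2 (pow_pos hd0 2)
  nlinarith

end BL
end
end

section
/- Let ν > 0 and let (ξ₀, ζ₀) be a bounded solution on ℝ of the system ξ₀′ − ζ₀ = g₀⁽¹⁾, ζ₀′ + ν ξ₀ = g₀⁽²⁾ with ξ₀′ and ζ₀′ also bounded and g₀⁽¹⁾, g₀⁽²⁾ continuous. If ξ₀(q₀) = ζ₀(q₀) = 0 for some q₀ ∈ ℝ, then for every θ > 0 the inequality ‖ξ₀‖²_{θ,q₀} + ‖ζ₀‖²_{θ,q₀} ≤ C₂ ‖g₀⁽¹⁾‖²_{θ,q₀} + C₃ ‖g₀⁽²⁾‖²_{θ,q₀} holds, where C₂ > 0 depends only on θ and an upper bound for ν, and C₃ > 0 depends only on θ. -/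
noncomputable section
open MeasureTheory Set Filter Topology

namespace BL

lemma integrable_exp_neg_mul_abs_sub {θ : ℝ} (hθ : 0 < θ) (q0 : ℝ) :
    Integrable (fun q : ℝ => Real.exp (-θ * |q - q0|)) := by
  rw [← integrableOn_univ, ← Iic_union_Ioi (a := q0)]
  refine IntegrableOn.union ?_ ?_
  · refine IntegrableOn.congr_fun
      ((integrableOn_exp_mul_Iic hθ q0).mul_const (Real.exp (-θ * q0))) (fun q hq => ?_)
      measurableSet_Iic
    have hq : q ≤ q0 := hq
    simp only [← Real.exp_add, abs_of_nonpos (sub_nonpos.2 hq)]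
    ring_nf
  · refine IntegrableOn.congr_fun
      ((integrableOn_exp_mul_Ioi (neg_lt_zero.2 hθ) q0).mul_const (Real.exp (θ * q0)))
      (fun q hq => ?_) measurableSet_Ioi
    have hq : q0 < q := hq
    simp only [← Real.exp_add, abs_of_pos (sub_pos.2 hq)]
    ring_nf

lemma integrable_mul_exp_neg_mul_abs_sub {θ : ℝ} (hθ : 0 < θ) (q0 : ℝ) {u : ℝ → ℝ}
    (hu : Continuous u) {K : ℝ} (hK : ∀ q, |u q| ≤ K) :
    Integrable (fun q : ℝ => u q * Real.exp (-θ * |q - q0|)) :=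
  (integrable_exp_neg_mul_abs_sub hθ q0).bdd_mul hu.aestronglyMeasurable
    (Eventually.of_forall hK)

/-- A weighted Grönwall inequality: the boundary terms vanish since `F` is bounded and
`F q0 = 0`. -/
lemma integral_mul_exp_nonneg_of_abs_deriv_le {θ : ℝ} (hθ : 0 < θ) {q0 : ℝ}
    {F F' D : ℝ → ℝ} (hF : ∀ q, HasDerivAt F (F' q) q) (hF' : Continuous F')
    {K K' : ℝ} (hK : ∀ q, |F q| ≤ K) (hK' : ∀ q, |F' q| ≤ K') (h0 : F q0 = 0)
    (hD : Integrable (fun q => D q * Real.exp (-θ * |q - q0|)))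
    (hle : ∀ q, |F' q| ≤ θ * F q + D q) :
    0 ≤ ∫ q, D q * Real.exp (-θ * |q - q0|) := by
  have hFc : Continuous F := continuous_iff_continuousAt.2 fun q => (hF q).continuousAt
  have hFi := integrable_mul_exp_neg_mul_abs_sub hθ q0 hFc hK
  have hFi' := integrable_mul_exp_neg_mul_abs_sub hθ q0 hF' hK'
  have hright : 0 ≤ ∫ q in Ioi q0, D q * Real.exp (-θ * |q - q0|) := by
    have hint : IntegrableOn (fun q => F' q * Real.exp (-θ * (q - q0))
        + F q * (Real.exp (-θ * (q - q0)) * (-θ))) (Ioi q0) := by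
      refine IntegrableOn.congr_fun (hFi'.add (hFi.mul_const (-θ))).integrableOn
        (fun q hq => ?_) measurableSet_Ioi
      have hq : q0 < q := hq
      simp only [Pi.add_apply, abs_of_pos (sub_pos.2 hq)]
      ring
    have hlim : Tendsto (fun q => F q * Real.exp (-θ * (q - q0))) atTop (𝓝 0) := by
      have he : Tendsto (fun q : ℝ => Real.exp (-θ * (q - q0))) atTop (𝓝 0) :=
        Real.tendsto_exp_atBot.comp
          ((tendsto_atTop_add_const_right _ (-q0) tendsto_id).const_mul_atTop_of_neg
            (neg_lt_zero.2 hθ))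
      exact bdd_le_mul_tendsto_zero' K (Eventually.of_forall hK) he
    have hval := integral_Ioi_of_hasDerivAt_of_tendsto' (a := q0) (fun q _ =>
      (hF q).mul (((hasDerivAt_id' q).sub_const q0 |>.const_mul (-θ)).exp.congr_deriv
        (by simp))) hint hlim
    simp only [Pi.mul_apply, h0, zero_mul, sub_zero] at hval
    rw [← hval]
    refine setIntegral_mono_on hint hD.integrableOn measurableSet_Ioi fun q hq => ?_
    have hq : q0 < q := hq
    rw [abs_of_pos (sub_pos.2 hq)]
    nlinarith [mul_le_mul_of_nonneg_right ((le_abs_self _).trans (hle q))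
      (Real.exp_pos (-θ * (q - q0))).le]
  have hleft : 0 ≤ ∫ q in Iic q0, D q * Real.exp (-θ * |q - q0|) := by
    have hint : IntegrableOn (fun q => F' q * Real.exp (θ * (q - q0))
        + F q * (Real.exp (θ * (q - q0)) * θ)) (Iic q0) := by
      refine IntegrableOn.congr_fun (hFi'.add (hFi.mul_const θ)).integrableOn
        (fun q hq => ?_) measurableSet_Iic
      have hq : q ≤ q0 := hq
      simp only [Pi.add_apply, abs_of_nonpos (sub_nonpos.2 hq), mul_neg, neg_mul, neg_neg]
      ring
    have hlim : Tendsto (fun q => F q * Real.exp (θ * (q - q0))) atBot (𝓝 0) := by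
      have he : Tendsto (fun q : ℝ => Real.exp (θ * (q - q0))) atBot (𝓝 0) :=
        Real.tendsto_exp_atBot.comp
          ((tendsto_atBot_add_const_right _ (-q0) tendsto_id).const_mul_atBot hθ)
      exact bdd_le_mul_tendsto_zero' K (Eventually.of_forall hK) he
    have hval := integral_Iic_of_hasDerivAt_of_tendsto' (a := q0) (fun q _ =>
      (hF q).mul (((hasDerivAt_id' q).sub_const q0 |>.const_mul θ).exp.congr_deriv
        (by simp))) hint hlim
    simp only [Pi.mul_apply, h0, zero_mul, sub_zero] at hval
    rw [← neg_zero, ← hval, ← integral_neg]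
    refine setIntegral_mono_on hint.neg hD.integrableOn measurableSet_Iic fun q hq => ?_
    have hq : q ≤ q0 := hq
    simp only [abs_of_nonpos (sub_nonpos.2 hq), mul_neg, neg_mul, neg_neg]
    nlinarith [mul_le_mul_of_nonneg_right ((neg_le_abs _).trans (hle q))
      (Real.exp_pos (θ * (q - q0))).le]
  rw [← intervalIntegral.integral_Iic_add_Ioi hD.integrableOn hD.integrableOn]
  exact add_nonneg hleft hright

/-- Young's inequality with parameter. -/
lemma abs_two_mul_le {ε : ℝ} (hε : 0 < ε) (x y : ℝ) :
    |2 * (x * y)| ≤ ε * x ^ 2 + ε⁻¹ * y ^ 2 := by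
  have h : ε * x ^ 2 + ε⁻¹ * y ^ 2 - 2 * (x * y) = ε * (x - ε⁻¹ * y) ^ 2 := by
    field_simp
    ring
  have h' : ε * x ^ 2 + ε⁻¹ * y ^ 2 + 2 * (x * y) = ε * (x + ε⁻¹ * y) ^ 2 := by
    field_simp
    ring
  have := mul_nonneg hε.le (sq_nonneg (x - ε⁻¹ * y))
  have := mul_nonneg hε.le (sq_nonneg (x + ε⁻¹ * y))
  exact abs_le.2 ⟨by linarith, by linarith⟩

/-- Lemma 5.5, second part (estimate under homogeneous Cauchy data at q₀). -/
theorem statement14 :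
    ∀ θ : ℝ, 0 < θ →
      ∃ C3 : ℝ, 0 < C3 ∧
        ∀ N : ℝ, 0 < N →
          ∃ C2 : ℝ, 0 < C2 ∧
            ∀ ν : ℝ, 0 < ν → ν ≤ N →
              ∀ ξ0 ζ0 ξ0' ζ0' g1 g2 : ℝ → ℝ,
                (∀ q : ℝ, HasDerivAt ξ0 (ξ0' q) q) →
                (∀ q : ℝ, HasDerivAt ζ0 (ζ0' q) q) →
                (∃ B : ℝ, ∀ q : ℝ,
                  |ξ0 q| ≤ B ∧ |ζ0 q| ≤ B ∧ |ξ0' q| ≤ B ∧ |ζ0' q| ≤ B) →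
                Continuous g1 → Continuous g2 →
                (∀ q : ℝ, ξ0' q - ζ0 q = g1 q) →
                (∀ q : ℝ, ζ0' q + ν * ξ0 q = g2 q) →
                ∀ q0 : ℝ, ξ0 q0 = 0 → ζ0 q0 = 0 →
                  wn1 θ q0 ξ0 + wn1 θ q0 ζ0 ≤
                    C2 * wn1 θ q0 g1 + C3 * wn1 θ q0 g2 := by
  intro θ hθ
  obtain ⟨A, hA⟩ : ∃ A, A = 2 / θ * (1 + 8 / θ ^ 2) := ⟨_, rfl⟩
  have hA0 : 0 < A := by rw [hA]; positivity
  refine ⟨2 * A / θ, by positivity, fun N hN => ⟨A * N / θ + 8 / θ ^ 2, by positivity, ?_⟩⟩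
  intro ν hν hνN ξ ζ ξ' ζ' g1 g2 hξ hζ ⟨B, hB⟩ hg1 hg2 h1 h2 q0 hξ0 hζ0
  have hB0 : 0 ≤ B := (abs_nonneg _).trans (hB 0).1
  have hξc : Continuous ξ := continuous_iff_continuousAt.2 fun q => (hξ q).continuousAt
  have hζc : Continuous ζ := continuous_iff_continuousAt.2 fun q => (hζ q).continuousAt
  have hξc' : Continuous ξ' := (hζc.add hg1).congr fun q => by simp [← h1 q]
  have hζc' : Continuous ζ' :=
    (hg2.sub (hξc.const_mul ν)).congr fun q => by simp [← h2 q]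
  have hsq {u : ℝ → ℝ} {K : ℝ} (hu : Continuous u) (hK : ∀ q, |u q| ≤ K) :
      Integrable (fun q => u q ^ 2 * Real.exp (-θ * |q - q0|)) := by
    refine integrable_mul_exp_neg_mul_abs_sub hθ q0 (hu.pow 2) (K := K ^ 2) fun q => ?_
    rw [abs_pow]
    exact pow_le_pow_left₀ (abs_nonneg _) (hK q) 2
  have hiξ := hsq hξc fun q => (hB q).1
  have hiζ := hsq hζc fun q => (hB q).2.1
  have hig1 := hsq hg1 (K := B + B) fun q => by
    rw [← h1 q]
    exact (abs_sub _ _).trans (add_le_add (hB q).2.2.1 (hB q).2.1)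
  have hig2 := hsq hg2 (K := B + ν * B) fun q => by
    rw [← h2 q]
    refine (abs_add_le _ _).trans (add_le_add (hB q).2.2.2 ?_)
    rw [abs_mul, abs_of_pos hν]
    exact mul_le_mul_of_nonneg_left (hB q).1 hν.le
  have hmul {u v : ℝ → ℝ} (hu : ∀ q, |u q| ≤ B) (hv : ∀ q, |v q| ≤ B) (q : ℝ) :
      |u q * v q| ≤ B * B := by
    rw [abs_mul]
    exact mul_le_mul (hu q) (hv q) (abs_nonneg _) hB0
  have hcomb (a b x y : ℝ) (ha : 0 < a) (hb : 0 < b) (hx : |x| ≤ B * B)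
      (hy : |y| ≤ B * B) : |a * x + b * y| ≤ (a + b) * (B * B) := by
    refine (abs_add_le _ _).trans ?_
    rw [abs_mul, abs_mul, abs_of_pos ha, abs_of_pos hb]
    nlinarith
  have key := integral_mul_exp_nonneg_of_abs_deriv_le hθ (q0 := q0)
    (F := fun q => (A * ν + 2 / θ) * (ξ q * ξ q) + A * (ζ q * ζ q))
    (F' := fun q => (2 * (A * ν + 2 / θ)) * (ξ q * ξ' q) + (2 * A) * (ζ q * ζ' q))
    (D := fun q => (A * N / θ + 8 / θ ^ 2) * g1 q ^ 2 + 2 * A / θ * g2 q ^ 2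
      - (ξ q ^ 2 + ζ q ^ 2))
    (fun q => ((((hξ q).mul (hξ q)).const_mul _).add
      (((hζ q).mul (hζ q)).const_mul _)).congr_deriv (by ring))
    (by fun_prop)
    (fun q => hcomb _ _ _ _ (by positivity) hA0 (hmul (fun q => (hB q).1) (fun q => (hB q).1) q)
      (hmul (fun q => (hB q).2.1) (fun q => (hB q).2.1) q))
    (fun q => hcomb _ _ _ _ (by positivity) (by positivity)
      (hmul (fun q => (hB q).1) (fun q => (hB q).2.2.1) q)
      (hmul (fun q => (hB q).2.1) (fun q => (hB q).2.2.2) q))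
    (by simp [hξ0, hζ0])
    (by
      refine (((hig1.const_mul (A * N / θ + 8 / θ ^ 2)).add (hig2.const_mul (2 * A / θ))).sub
        (hiξ.add hiζ)).congr (Eventually.of_forall fun q => ?_)
      simp only [Pi.add_apply, Pi.sub_apply]
      ring)
    (fun q => by
      have e1 : ξ' q = ζ q + g1 q := by linarith [h1 q]
      have e2 : ζ' q = g2 q - ν * ξ q := by linarith [h2 q]
      have y1 := mul_le_mul_of_nonneg_left (abs_le.1 (abs_two_mul_le hθ (ξ q) (g1 q))).1
        (mul_pos hA0 hν).le
      have y1' := mul_le_mul_of_nonneg_left (abs_le.1 (abs_two_mul_le hθ (ξ q) (g1 q))).2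
        (mul_pos hA0 hν).le
      have y2 := mul_le_mul_of_nonneg_left
        (abs_le.1 (abs_two_mul_le (half_pos hθ) (ζ q) (g2 q))).1 hA0.le
      have y2' := mul_le_mul_of_nonneg_left
        (abs_le.1 (abs_two_mul_le (half_pos hθ) (ζ q) (g2 q))).2 hA0.le
      have y3 := mul_le_mul_of_nonneg_left
        (abs_le.1 (abs_two_mul_le (half_pos hθ) (ξ q) (ζ q + g1 q))).1 (div_pos two_pos hθ).le
      have y3' := mul_le_mul_of_nonneg_left
        (abs_le.1 (abs_two_mul_le (half_pos hθ) (ξ q) (ζ q + g1 q))).2 (div_pos two_pos hθ).le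
      have y4 : 4 / θ ^ 2 * (ζ q + g1 q) ^ 2 ≤ 4 / θ ^ 2 * (2 * ζ q ^ 2 + 2 * g1 q ^ 2) :=
        mul_le_mul_of_nonneg_left (by nlinarith [sq_nonneg (ζ q - g1 q)]) (by positivity)
      have y5 : A * ν / θ * g1 q ^ 2 ≤ A * N / θ * g1 q ^ 2 := by gcongr
      have c1 : A * (θ / 2) = 1 + 8 / θ ^ 2 := by rw [hA]; field_simp
      have hmain : A * ν * (θ * ξ q ^ 2 + θ⁻¹ * g1 q ^ 2)
          + A * (θ / 2 * ζ q ^ 2 + (θ / 2)⁻¹ * g2 q ^ 2)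
          + 2 / θ * (θ / 2 * ξ q ^ 2 + (θ / 2)⁻¹ * (ζ q + g1 q) ^ 2)
          ≤ θ * ((A * ν + 2 / θ) * (ξ q * ξ q) + A * (ζ q * ζ q))
            + ((A * N / θ + 8 / θ ^ 2) * g1 q ^ 2 + 2 * A / θ * g2 q ^ 2
              - (ξ q ^ 2 + ζ q ^ 2)) := by
        have e3 : A * ν * (θ * ξ q ^ 2 + θ⁻¹ * g1 q ^ 2)
            + A * (θ / 2 * ζ q ^ 2 + (θ / 2)⁻¹ * g2 q ^ 2)
            + 2 / θ * (θ / 2 * ξ q ^ 2 + (θ / 2)⁻¹ * (ζ q + g1 q) ^ 2)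
            = A * ν * θ * ξ q ^ 2 + A * ν / θ * g1 q ^ 2 + A * (θ / 2) * ζ q ^ 2
              + 2 * A / θ * g2 q ^ 2 + ξ q ^ 2 + 4 / θ ^ 2 * (ζ q + g1 q) ^ 2 := by
          field_simp
          ring
        have e4 : θ * ((A * ν + 2 / θ) * (ξ q * ξ q) + A * (ζ q * ζ q))
            = A * ν * θ * ξ q ^ 2 + 2 * ξ q ^ 2 + 2 * (A * (θ / 2)) * ζ q ^ 2 := by
          field_simp
        have c2 : 8 / θ ^ 2 = 2 * (4 / θ ^ 2) := by ring
        rw [e3, e4, c1, c2]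
        linarith
      refine le_trans ?_ hmain
      rw [e1, e2]
      exact abs_le.2 ⟨by linarith, by linarith⟩)
  have hval : (∫ q, ((A * N / θ + 8 / θ ^ 2) * g1 q ^ 2 + 2 * A / θ * g2 q ^ 2
      - (ξ q ^ 2 + ζ q ^ 2)) * Real.exp (-θ * |q - q0|))
      = (A * N / θ + 8 / θ ^ 2) * wn1 θ q0 g1 + 2 * A / θ * wn1 θ q0 g2
        - (wn1 θ q0 ξ + wn1 θ q0 ζ) := by
    unfold wn1
    rw [← integral_const_mul, ← integral_const_mul,
      ← integral_add (hig1.const_mul _) (hig2.const_mul _), ← integral_add hiξ hiζ]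
    refine Eq.trans (integral_congr_ae (Eventually.of_forall fun q => ?_))
      (integral_sub ((hig1.const_mul _).add (hig2.const_mul _)) (hiξ.add hiζ))
    beta_reduce
    ring
  linarith [key.trans_eq hval]

end BL
end
end
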